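/- Let p be an odd prime and n a positive integer with p^n ≡ 3 (mod 4), and let χ be the quadratic character of F_{p^n}. Then the number of triples (y₁,y₂,y₃) ∈ (F_{p^n}\{0})³ with χ(y₁) = χ(y₂) = χ(y₃) = −1 satisfying y₁ − y₂ + y₃ − 1 = 0 and y₁² − y₂² + y₃² = 0 equals (1/8)·(p^n + 1 + (χ(2) − 1)·λ_{p,n}), where λ_{p,n} denotes the sum over all x in F_{p^n} of χ(x·(x² − 2x − 1)). -/

import Mathlib

open Finset

section QuadraticCharSums

variable {F : Type*} [Field F] [Fintype F]

/-- The sum of an odd integer-valued function over a finite field vanishes. -/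
theorem sum_eq_zero_of_odd (f : F → ℤ) (hf : ∀ x, f (-x) = -f x) : ∑ x, f x = 0 := by
  have h := Equiv.sum_comp (Equiv.neg F) f
  simp only [Equiv.neg_apply, hf, sum_neg_distrib] at h
  omega

/-- Invariance of a sum over a finite field under an affine change of variable. -/
theorem sum_comp_affine (f : F → ℤ) {a : F} (ha : a ≠ 0) (b : F) :
    ∑ x, f (a * x + b) = ∑ x, f x :=
  Equiv.sum_comp ((Equiv.mulLeft₀ a ha).trans (Equiv.addRight b)) f

theorem sum_comp_inv (f : F → ℤ) : ∑ x, f x⁻¹ = ∑ x, f x :=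
  Equiv.sum_comp (Equiv.inv F) f

variable [DecidableEq F]

theorem quadraticChar_mul_sq (x : F) {y : F} (hy : y ≠ 0) :
    quadraticChar F (x * y ^ 2) = quadraticChar F x := by
  rw [map_mul, quadraticChar_sq_one' hy, mul_one]

theorem quadraticChar_div (x : F) {y : F} (hy : y ≠ 0) :
    quadraticChar F (x / y) = quadraticChar F (x * y) := by
  rw [← quadraticChar_mul_sq (x / y) hy]
  congr 1
  field_simp

theorem sum_ite_sq_eq (hF : ringChar F ≠ 2) (t : F) (c : ℤ) :
    ∑ x : F, (if x ^ 2 = t then c else 0) = c * (quadraticChar F t + 1) := by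
  rw [← quadraticChar_card_sqrts hF t, ← sum_filter, sum_const, nsmul_eq_mul, mul_comm]
  congr 3
  ext x
  simp

theorem sum_comp_sq (hF : ringChar F ≠ 2) (f : F → ℤ) :
    ∑ x, f (x ^ 2) = ∑ t, f t * (quadraticChar F t + 1) := by
  calc ∑ x, f (x ^ 2) = ∑ x : F, ∑ t, if x ^ 2 = t then f t else 0 := by simp
    _ = ∑ t, ∑ x : F, if x ^ 2 = t then f t else 0 := sum_comm
    _ = _ := by simp only [sum_ite_sq_eq hF]

/-- The character sums attached to `y² = x (x² + a x + b)` and to its two-isogenous curve agree. -/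
theorem sum_quadraticChar_two_isogeny (hF : ringChar F ≠ 2) (a : F) {b : F} (hb : b ≠ 0) :
    ∑ x, quadraticChar F (x * (x ^ 2 + a * x + b)) =
      ∑ x, quadraticChar F (x * (x ^ 2 - 2 * a * x + (a ^ 2 - 4 * b))) := by
  have h2 : (2 : F) ≠ 0 := Ring.two_ne_zero hF
  have key : ∀ x : F, quadraticChar F (x * (x ^ 2 + a * x + b)) =
      ∑ t, if (2 * x + -t) ^ 2 = t ^ 2 - 4 * b then quadraticChar F (t + a) else 0 := by
    intro x
    have hiff : ∀ t, (2 * x + -t) ^ 2 = t ^ 2 - 4 * b ↔ x ^ 2 + b = t * x := by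
      intro t
      constructor
      · intro h
        apply mul_left_cancel₀ (mul_ne_zero h2 h2)
        linear_combination h
      · intro h
        linear_combination 4 * h
    simp only [hiff]
    by_cases hx : x = 0
    · simp [hx, hb]
    · have : ∀ t, (x ^ 2 + b = t * x) ↔ (x ^ 2 + b) / x = t := by
        intro t
        rw [div_eq_iff hx]
      simp only [this, sum_ite_eq, mem_univ, if_true]
      rw [← quadraticChar_mul_sq ((x ^ 2 + b) / x + a) hx]
      congr 1
      field_simp
      ring
  calc ∑ x, quadraticChar F (x * (x ^ 2 + a * x + b))
      = ∑ t, ∑ x : F,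
          if (2 * x + -t) ^ 2 = t ^ 2 - 4 * b then quadraticChar F (t + a) else 0 := by
        rw [sum_comm]
        exact sum_congr rfl fun x _ => key x
    _ = ∑ t, quadraticChar F (t + a) * (quadraticChar F (t ^ 2 - 4 * b) + 1) := by
        refine sum_congr rfl fun t _ => ?_
        rw [← sum_ite_sq_eq hF]
        exact sum_comp_affine
          (fun y => if y ^ 2 = t ^ 2 - 4 * b then quadraticChar F (t + a) else 0) h2 (-t)
    _ = ∑ t, quadraticChar F ((t + a) * (t ^ 2 - 4 * b)) + ∑ t, quadraticChar F (1 * t + a) := by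
        rw [← sum_add_distrib]
        refine sum_congr rfl fun t _ => ?_
        rw [map_mul, one_mul]
        ring
    _ = ∑ t, quadraticChar F ((t + a) * (t ^ 2 - 4 * b)) := by
        rw [sum_comp_affine (fun x => quadraticChar F x) one_ne_zero, quadraticChar_sum_zero hF,
          add_zero]
    _ = _ := by
        rw [← sum_comp_affine _ one_ne_zero (-a)]
        refine sum_congr rfl fun t _ => ?_
        congr 1
        ring

theorem sum_quadraticChar_mul_sub_one (hF : ringChar F ≠ 2) :
    ∑ x, quadraticChar F (x * (x - 1)) = -1 := by
  have key : ∀ x : F, quadraticChar F (x * (x - 1)) =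
      quadraticChar F (-1 * x⁻¹ + 1) - if x = 0 then 1 else 0 := by
    intro x
    by_cases hx : x = 0
    · simp [hx]
    · rw [if_neg hx, sub_zero, ← quadraticChar_mul_sq (-1 * x⁻¹ + 1) hx]
      congr 1
      field_simp
      ring
  rw [sum_congr rfl fun x _ => key x, sum_sub_distrib,
    sum_comp_inv (fun x => quadraticChar F (-1 * x + 1)),
    sum_comp_affine (fun x => quadraticChar F x) (neg_ne_zero.mpr one_ne_zero),
    quadraticChar_sum_zero hF]
  simp

theorem sum_quadraticChar_sq_sub_one (hF : ringChar F ≠ 2) :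
    ∑ x, quadraticChar F (x ^ 2 - 1) = -1 := by
  have h2 : (2 : F) ≠ 0 := Ring.two_ne_zero hF
  rw [← sum_quadraticChar_mul_sub_one hF,
    ← sum_comp_affine (fun x => quadraticChar F (x ^ 2 - 1)) h2 (-1)]
  refine sum_congr rfl fun x _ => ?_
  rw [← quadraticChar_mul_sq (x * (x - 1)) h2]
  congr 1
  ring

theorem sum_quadraticChar_odd (h1 : quadraticChar F (-1) = -1) (g : F → F)
    (hg : ∀ x, g (-x) = -1 * g x) : ∑ x, quadraticChar F (g x) = 0 :=
  sum_eq_zero_of_odd _ fun x => by rw [hg, map_mul, h1]; ring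

theorem sum_quadraticChar_pow_four_sub_one (hF : ringChar F ≠ 2)
    (h1 : quadraticChar F (-1) = -1) : ∑ x, quadraticChar F (x ^ 4 - 1) = -1 := by
  have h := sum_comp_sq hF (fun x => quadraticChar F (x ^ 2 - 1))
  simp only [mul_add, mul_one, sum_add_distrib, sum_quadraticChar_sq_sub_one hF, ← map_mul] at h
  rw [sum_quadraticChar_odd h1 (fun x => (x ^ 2 - 1) * x) (fun x => by ring), zero_add] at h
  rw [← h]
  refine sum_congr rfl fun x _ => ?_
  congr 1
  ring

theorem sum_quadraticChar_mul_sq_sub_add_two (hF : ringChar F ≠ 2)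
    (h1 : quadraticChar F (-1) = -1) :
    ∑ x, quadraticChar F (x * (x ^ 2 - 2 * x + 2)) =
      -quadraticChar F 2 * ∑ x, quadraticChar F (x * (x ^ 2 - 2 * x - 1)) := by
  have h2 : (2 : F) ≠ 0 := Ring.two_ne_zero hF
  have h := sum_quadraticChar_two_isogeny hF (-2) h2
  rw [← sum_comp_affine (fun x => quadraticChar F (x * (x ^ 2 - 2 * (-2) * x + _)))
    (neg_ne_zero.mpr h2) 0] at h
  simp only [neg_mul, ← sub_eq_add_neg] at h
  rw [h, mul_sum, ← neg_one_mul (quadraticChar F 2), ← h1, ← map_mul]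
  refine sum_congr rfl fun x _ => ?_
  rw [← map_mul, ← quadraticChar_mul_sq (-1 * 2 * _) h2]
  congr 1
  ring

theorem sum_quadraticChar_quartic :
    ∑ x, quadraticChar F (x * (x + 1) * (x ^ 2 + 1)) =
      ∑ x, quadraticChar F (x * (x ^ 2 - 2 * x + 2)) - 1 := by
  have key : ∀ x : F, quadraticChar F (x * (x + 1) * (x ^ 2 + 1)) =
      quadraticChar F ((1 + x⁻¹) * (1 + x⁻¹ ^ 2)) - if x = 0 then 1 else 0 := by
    intro x
    by_cases hx : x = 0
    · simp [hx]
    · rw [if_neg hx, sub_zero,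
        ← quadraticChar_mul_sq ((1 + x⁻¹) * (1 + x⁻¹ ^ 2)) (pow_ne_zero 2 hx)]
      congr 1
      field_simp
  rw [sum_congr rfl fun x _ => key x, sum_sub_distrib,
    sum_comp_inv (fun x => quadraticChar F ((1 + x) * (1 + x ^ 2))),
    ← sum_comp_affine (fun x => quadraticChar F (x * (x ^ 2 - 2 * x + 2))) one_ne_zero 1]
  congr 1
  · refine sum_congr rfl fun x _ => ?_
    congr 1
    ring
  · simp

theorem sum_quadraticChar_prod (hF : ringChar F ≠ 2) (h1 : quadraticChar F (-1) = -1) :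
    ∑ v, (1 - quadraticChar F (2 * (v + 1))) * (1 - quadraticChar F (v * (v - 1))) *
        (1 - quadraticChar F (2 * (v - 1) * (v ^ 2 + 1))) =
      Fintype.card F + 1 +
        (quadraticChar F 2 - 1) * ∑ x, quadraticChar F (x * (x ^ 2 - 2 * x - 1)) := by
  have h2 : (2 : F) ≠ 0 := Ring.two_ne_zero hF
  have sA : ∑ v, quadraticChar F (2 * (v + 1)) = 0 := by
    rw [← quadraticChar_sum_zero hF, ← sum_comp_affine (fun x => quadraticChar F x) h2 2]
    refine sum_congr rfl fun x _ => ?_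
    congr 1
    ring
  have sC : ∑ v, quadraticChar F (2 * (v - 1) * (v ^ 2 + 1)) =
      -quadraticChar F 2 * ∑ x, quadraticChar F (x * (x ^ 2 - 2 * x + 2)) := by
    rw [← sum_comp_affine _ (neg_ne_zero.mpr one_ne_zero) 1, mul_sum,
      ← neg_one_mul (quadraticChar F 2), ← h1, ← map_mul]
    refine sum_congr rfl fun x _ => ?_
    rw [← map_mul]
    congr 1
    ring
  have sAB : ∑ v, quadraticChar F (2 * (v + 1)) * quadraticChar F (v * (v - 1)) = 0 := by
    simp only [← map_mul]
    exact sum_quadraticChar_odd h1 _ fun x => by ring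
  have sAC : ∑ v, quadraticChar F (2 * (v + 1)) *
      quadraticChar F (2 * (v - 1) * (v ^ 2 + 1)) = -1 := by
    rw [← sum_quadraticChar_pow_four_sub_one hF h1]
    refine sum_congr rfl fun x _ => ?_
    rw [← map_mul, ← quadraticChar_mul_sq (x ^ 4 - 1) h2]
    congr 1
    ring
  have sBC : ∑ v, quadraticChar F (v * (v - 1)) *
      quadraticChar F (2 * (v - 1) * (v ^ 2 + 1)) = -1 := by
    have key : ∀ v : F, quadraticChar F (v * (v - 1)) *
        quadraticChar F (2 * (v - 1) * (v ^ 2 + 1)) =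
        quadraticChar F (2 * v * (v ^ 2 + 1)) - if v = 1 then 1 else 0 := by
      intro v
      by_cases hv : v = 1
      · have : (2 : F) * 1 * (1 ^ 2 + 1) = 2 ^ 2 := by ring
        simp only [hv, this, quadraticChar_sq_one' h2]
        simp
      · rw [if_neg hv, sub_zero, ← map_mul,
          ← quadraticChar_mul_sq (2 * v * (v ^ 2 + 1)) (sub_ne_zero.mpr hv)]
        congr 1
        ring
    rw [sum_congr rfl fun x _ => key x, sum_sub_distrib,
      sum_quadraticChar_odd h1 _ fun x => by ring]
    simp
  have sABC : ∑ v, quadraticChar F (2 * (v + 1)) * quadraticChar F (v * (v - 1)) *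
      quadraticChar F (2 * (v - 1) * (v ^ 2 + 1)) =
      ∑ x, quadraticChar F (x * (x ^ 2 - 2 * x + 2)) - 2 := by
    have key : ∀ v : F, quadraticChar F (2 * (v + 1)) * quadraticChar F (v * (v - 1)) *
        quadraticChar F (2 * (v - 1) * (v ^ 2 + 1)) =
        quadraticChar F (v * (v + 1) * (v ^ 2 + 1)) - if v = 1 then 1 else 0 := by
      intro v
      by_cases hv : v = 1
      · have : (1 : F) * (1 + 1) * (1 ^ 2 + 1) = 2 ^ 2 := by ring
        simp only [hv, this, quadraticChar_sq_one' h2]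
        simp
      · rw [if_neg hv, sub_zero, ← map_mul, ← map_mul,
          ← quadraticChar_mul_sq (v * (v + 1) * (v ^ 2 + 1))
            (mul_ne_zero h2 (sub_ne_zero.mpr hv))]
        congr 1
        ring
    rw [sum_congr rfl fun x _ => key x, sum_sub_distrib, sum_quadraticChar_quartic]
    simp
    ring
  have expand : ∀ A B C : ℤ, (1 - A) * (1 - B) * (1 - C) =
      1 - A - B - C + A * B + A * C + B * C - A * B * C := fun A B C => by ring
  simp only [expand, sum_sub_distrib, sum_add_distrib, sA, sum_quadraticChar_mul_sub_one hF, sC,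
    sAB, sAC, sBC, sABC, sum_quadraticChar_mul_sq_sub_add_two hF h1]
  have hsq := quadraticChar_sq_one h2
  simp only [sum_const, card_univ, nsmul_eq_mul, mul_one]
  linear_combination
    (-∑ x, quadraticChar F (x * (x ^ 2 - 2 * x - 1))) * hsq

theorem quadraticChar_prod_eq_ite (hF : ringChar F ≠ 2) (h1 : quadraticChar F (-1) = -1) (v : F) :
    (1 - quadraticChar F (2 * (v + 1))) * (1 - quadraticChar F (v * (v - 1))) *
        (1 - quadraticChar F (2 * (v - 1) * (v ^ 2 + 1))) =
      if quadraticChar F (2 * (v + 1)) = -1 ∧ quadraticChar F (v * (v - 1)) = -1 ∧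
        quadraticChar F (2 * (v - 1) * (v ^ 2 + 1)) = -1 then 8 else 0 := by
  have h2 : (2 : F) ≠ 0 := Ring.two_ne_zero hF
  have hχ2 := quadraticChar_dichotomy h2
  by_cases hv : v - 1 = 0
  · have : v = 1 := sub_eq_zero.mp hv
    subst this
    have : (2 : F) * (1 + 1) = 2 ^ 2 := by ring
    rw [this, quadraticChar_sq_one' h2]
    simp
  have hquad : v ^ 2 + 1 ≠ 0 := by
    intro h
    have hv0 : v ≠ 0 := by rintro rfl; simp at h
    have := quadraticChar_sq_one' hv0
    rw [eq_neg_of_add_eq_zero_left h, h1] at this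
    norm_num at this
  by_cases h0 : v = 0
  · subst h0
    have : (2 : F) * (0 - 1) * (0 ^ 2 + 1) = -1 * 2 := by ring
    rw [this, map_mul (quadraticChar F) (-1) 2, h1]
    rcases hχ2 with h | h <;> simp [h]
  by_cases hm : v + 1 = 0
  · have : v = -1 := eq_neg_of_add_eq_zero_left hm
    subst this
    have e1 : (2 : F) * (-1 - 1) * ((-1) ^ 2 + 1) = -1 * 2 * 2 ^ 2 := by ring
    have e2 : (-1 : F) * (-1 - 1) = 2 := by ring
    rw [e1, e2, quadraticChar_mul_sq _ h2, map_mul (quadraticChar F) (-1) 2, h1]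
    rcases hχ2 with h | h <;> simp [h]
  rcases quadraticChar_dichotomy (mul_ne_zero h2 hm) with hA | hA <;>
  rcases quadraticChar_dichotomy (mul_ne_zero h0 hv) with hB | hB <;>
  rcases quadraticChar_dichotomy (mul_ne_zero (mul_ne_zero h2 hv) hquad) with hC | hC <;>
  rw [hA, hB, hC] <;> norm_num

theorem ncard_eq_card_filter (hF : ringChar F ≠ 2) :
    Set.ncard {y : F × F × F |
        y.1 ≠ 0 ∧ y.2.1 ≠ 0 ∧ y.2.2 ≠ 0 ∧
        quadraticChar F y.1 = -1 ∧ quadraticChar F y.2.1 = -1 ∧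
        quadraticChar F y.2.2 = -1 ∧
        y.1 - y.2.1 + y.2.2 - 1 = 0 ∧
        y.1 ^ 2 - y.2.1 ^ 2 + y.2.2 ^ 2 = 0} =
      #{v : F | quadraticChar F (2 * (v + 1)) = -1 ∧ quadraticChar F (v * (v - 1)) = -1 ∧
        quadraticChar F (2 * (v - 1) * (v ^ 2 + 1)) = -1} := by
  have h2 : (2 : F) ≠ 0 := Ring.two_ne_zero hF
  have hne : ∀ x : F, quadraticChar F x = -1 → x ≠ 0 := by
    rintro x hx rfl
    simp at hx
  have hchar : ∀ v : F, v - 1 ≠ 0 →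
      quadraticChar F ((v + 1) / 2) = quadraticChar F (2 * (v + 1)) ∧
      quadraticChar F (v / (v - 1)) = quadraticChar F (v * (v - 1)) ∧
      quadraticChar F ((v ^ 2 + 1) / (2 * (v - 1))) =
        quadraticChar F (2 * (v - 1) * (v ^ 2 + 1)) := by
    intro v hv
    rw [quadraticChar_div _ h2, quadraticChar_div _ hv, quadraticChar_div _ (mul_ne_zero h2 hv),
      mul_comm (v + 1), mul_comm (v ^ 2 + 1)]
    exact ⟨rfl, rfl, rfl⟩
  have hparam : ∀ y₁ y₂ y₃ : F, y₁ - y₂ + y₃ - 1 = 0 → y₁ ^ 2 - y₂ ^ 2 + y₃ ^ 2 = 0 →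
      ∃ v, v - 1 ≠ 0 ∧ v = 2 * y₁ - 1 ∧ y₁ = (v + 1) / 2 ∧
        y₂ = (v ^ 2 + 1) / (2 * (v - 1)) ∧ y₃ = v / (v - 1) := by
    intro y₁ y₂ y₃ hlin hquad
    have hprod : 2 * (y₁ - 1) * (y₃ - 1) = 1 := by
      linear_combination (y₁ + y₂ + y₃ - 1) * hlin - hquad
    have hv : 2 * y₁ - 1 - 1 ≠ 0 := by
      intro h
      apply one_ne_zero (α := F)
      linear_combination (y₃ - 1) * h - hprod
    refine ⟨2 * y₁ - 1, hv, rfl, ?_, ?_, ?_⟩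
    · field_simp
      ring
    · rw [eq_div_iff (mul_ne_zero h2 hv)]
      linear_combination 2 * hprod - 4 * (y₁ - 1) * hlin
    · rw [eq_div_iff hv]
      linear_combination hprod
  rw [← Set.ncard_coe_finset]
  refine Set.ncard_congr (fun y _ => 2 * y.1 - 1) ?_ ?_ ?_
  · rintro ⟨y₁, y₂, y₃⟩ ⟨-, -, -, hy₁, hy₂, hy₃, hlin, hquad⟩
    obtain ⟨v, hv, hvy, rfl, rfl, rfl⟩ := hparam y₁ y₂ y₃ hlin hquad
    obtain ⟨e1, e2, e3⟩ := hchar v hv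
    simp only [coe_filter, mem_univ, true_and, Set.mem_ofPred_eq, ← hvy]
    exact ⟨e1 ▸ hy₁, e2 ▸ hy₃, e3 ▸ hy₂⟩
  · rintro ⟨y₁, y₂, y₃⟩ ⟨z₁, z₂, z₃⟩ ⟨-, -, -, -, -, -, hlin, hquad⟩
      ⟨-, -, -, -, -, -, hlin', hquad'⟩ h
    obtain ⟨v, -, hvy, rfl, rfl, rfl⟩ := hparam y₁ y₂ y₃ hlin hquad
    obtain ⟨w, -, hwz, rfl, rfl, rfl⟩ := hparam z₁ z₂ z₃ hlin' hquad'
    have hvw : v = w := hvy.trans (h.trans hwz.symm)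
    rw [hvw]
  · intro v hv
    simp only [coe_filter, mem_univ, true_and, Set.mem_ofPred_eq] at hv
    obtain ⟨hA, hB, hC⟩ := hv
    have hv1 : v - 1 ≠ 0 := right_ne_zero_of_mul (hne _ hB)
    obtain ⟨e1, e2, e3⟩ := hchar v hv1
    rw [← e1] at hA
    rw [← e2] at hB
    rw [← e3] at hC
    refine ⟨((v + 1) / 2, (v ^ 2 + 1) / (2 * (v - 1)), v / (v - 1)),
      ⟨hne _ hA, hne _ hC, hne _ hB, hA, hC, hB, ?_, ?_⟩, ?_⟩
    · dsimp only
      field_simp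
      ring
    · dsimp only
      field_simp
      ring
    · dsimp only
      field_simp
      ring

end QuadraticCharSums


theorem stmt_9 (p n : ℕ) (hp : p.Prime) (hodd : p ≠ 2) (hn : 0 < n)
    (h3 : p ^ n % 4 = 3)
    (F : Type*) [Field F] [Fintype F] [DecidableEq F]
    (hcard : Fintype.card F = p ^ n) :
    (Set.ncard {y : F × F × F |
        y.1 ≠ 0 ∧ y.2.1 ≠ 0 ∧ y.2.2 ≠ 0 ∧
        quadraticChar F y.1 = -1 ∧ quadraticChar F y.2.1 = -1 ∧
        quadraticChar F y.2.2 = -1 ∧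
        y.1 - y.2.1 + y.2.2 - 1 = 0 ∧
        y.1 ^ 2 - y.2.1 ^ 2 + y.2.2 ^ 2 = 0} : ℚ) =
      1/8 * ((p : ℚ) ^ n + 1 +
        (((quadraticChar F 2 : ℤ) : ℚ) - 1) *
          ((∑ x : F, quadraticChar F (x * (x ^ 2 - 2 * x - 1)) : ℤ) : ℚ)) := by
  have hF : ringChar F ≠ 2 := by
    intro h
    have := FiniteField.even_card_of_char_two h
    omega
  have h1 : quadraticChar F (-1) = -1 := by
    rw [quadraticChar_neg_one hF, ZMod.χ₄_nat_three_mod_four (by omega)]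
  have h := sum_quadraticChar_prod hF h1
  rw [sum_congr rfl fun v _ => quadraticChar_prod_eq_ite hF h1 v, ← sum_filter, sum_const,
    ← ncard_eq_card_filter hF, hcard, nsmul_eq_mul] at h
  have h' := congrArg (Int.cast : ℤ → ℚ) h
  push_cast at h' ⊢
  linarith
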